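/- arXiv:2301.12771 — 11 statements merged into one kernel-verified Lean document; each statement's English description precedes it below -/
import Mathlib

section
/- Let k be an algebraically closed field of characteristic 0 and let A, B ⊆ k with A ≠ ∅ and A ≠ k. If A ≤_p B, then either A and B are both finite and the number of elements of B is at most the number of elements of A, or the cardinality of A equals the cardinality of B (as cardinals). -/
open Pointwise

/-- `A` polynomially reduces to `B`: some polynomial `P` satisfies `A = P⁻¹(B)`. -/
def PolyRed {k : Type*} [Field k] (A B : Set k) : Prop :=
  ∃ P : Polynomial k, A = {x : k | Polynomial.eval x P ∈ B}

/-- `A` and `B` are polynomially bireducible. -/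
def PolyEquiv {k : Type*} [Field k] (A B : Set k) : Prop :=
  PolyRed A B ∧ PolyRed B A

/-- A nonconstant polynomial has finite fibres. -/
theorem Polynomial.finite_setOf_eval_eq {k : Type*} [Field k] {P : Polynomial k}
    (hP : 0 < P.natDegree) (b : k) : {x : k | P.eval x = b}.Finite := by
  have hne : P - Polynomial.C b ≠ 0 := fun h0 => by
    rw [sub_eq_zero.1 h0, Polynomial.natDegree_C] at hP
    exact hP.false
  refine (Polynomial.finite_setOfPred_isRoot hne).subset fun x hx => ?_
  simpa [Polynomial.IsRoot, sub_eq_zero] using hx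

/-- A nonconstant polynomial over an algebraically closed field is surjective. -/
theorem Polynomial.eval_surjective_of_natDegree_pos {k : Type*} [Field k] [IsAlgClosed k]
    {P : Polynomial k} (hP : 0 < P.natDegree) : Function.Surjective fun x => P.eval x := by
  intro b
  have hdeg : (P - Polynomial.C b).degree ≠ 0 := by
    rw [Polynomial.degree_sub_C (Polynomial.natDegree_pos_iff_degree_pos.1 hP)]
    exact (Polynomial.natDegree_pos_iff_degree_pos.1 hP).ne'
  obtain ⟨x, hx⟩ := IsAlgClosed.exists_root _ hdeg
  exact ⟨x, by simpa [Polynomial.IsRoot, sub_eq_zero] using hx⟩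

/-- The preimage of an infinite set under a map with finite fibres is no larger than the set. -/
theorem Cardinal.mk_preimage_le_of_finite_fibers.{u} {α β : Type u} {f : α → β}
    (hf : ∀ b, (f ⁻¹' {b}).Finite) {B : Set β} (hB : B.Infinite) :
    Cardinal.mk (f ⁻¹' B) ≤ Cardinal.mk B := by
  have hB' : Cardinal.aleph0 ≤ Cardinal.mk B := Cardinal.infinite_iff.1 hB.to_subtype
  rw [← Set.biUnion_preimage_singleton]
  refine (Cardinal.mk_biUnion_le _ _).trans ?_
  refine Cardinal.mul_le_of_le hB' le_rfl ?_
  exact (ciSup_le' fun b : B => (hf b).lt_aleph0.le).trans hB'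

theorem cardinality_of_polyRed {k : Type*} [Field k] [IsAlgClosed k] [CharZero k]
    (A B : Set k) (hA0 : A ≠ ∅) (hAk : A ≠ Set.univ) (h : PolyRed A B) :
    (A.Finite ∧ B.Finite ∧ B.ncard ≤ A.ncard) ∨ Cardinal.mk A = Cardinal.mk B := by
  obtain ⟨P, hP⟩ := h
  have hdeg : 0 < P.natDegree := by
    rw [Nat.pos_iff_ne_zero]
    intro h0
    obtain ⟨c, rfl⟩ := Polynomial.natDegree_eq_zero.1 h0
    by_cases hc : c ∈ B
    · exact hAk (by simp [hP, hc])
    · exact hA0 (by simp [hP, hc])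
  have hsurj := Polynomial.eval_surjective_of_natDegree_pos hdeg
  have hfib (b : k) : ((fun x => P.eval x) ⁻¹' {b}).Finite :=
    Polynomial.finite_setOf_eval_eq hdeg b
  change A = (fun x => P.eval x) ⁻¹' B at hP
  have himage : (fun x => P.eval x) '' A = B := by
    rw [hP, Set.image_preimage_eq _ hsurj]
  rcases A.finite_or_infinite with hA | hA
  · left
    refine ⟨hA, himage ▸ hA.image _, ?_⟩
    rw [← himage]
    exact Set.ncard_image_le hA
  · right
    have hB : B.Infinite := fun hB =>
      hA (hP ▸ hB.preimage' fun b _ => hfib b)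
    refine le_antisymm ?_ ?_
    · rw [hP]
      exact Cardinal.mk_preimage_le_of_finite_fibers hfib hB
    · rw [← himage]
      exact Cardinal.mk_image_le
end

section
/- Let k be an algebraically closed field of characteristic 0, let n ≥ 2, and let A, B ⊆ k be finite sets each with exactly n elements. If P ∈ k[X] is a polynomial such that A = {x ∈ k | P(x) ∈ B}, then P has degree 1. -/
open Pointwise

open Polynomial in
/-- If a nonconstant polynomial maps exactly the finite set `A` into the finite set `B`, then
counting fibres with multiplicity, and bounding the excess by the zeros of the derivative, gives
`|B| * deg P ≤ |A| + (deg P - 1)`. -/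
theorem card_mul_natDegree_le_of_preimage_eq {k : Type*} [Field k] [IsAlgClosed k] [CharZero k]
    (A B : Finset k) (P : k[X]) (hd : P.natDegree ≠ 0) (hP : ∀ x, x ∈ A ↔ P.eval x ∈ B) :
    B.card * P.natDegree ≤ A.card + (P.natDegree - 1) := by
  classical
  have hne (b : k) : P - C b ≠ 0 := fun h ↦ hd (by rw [sub_eq_zero.mp h, natDegree_C])
  have hfib : ∑ a ∈ A, (P - C (P.eval a)).rootMultiplicity a = B.card * P.natDegree := by
    rw [← Finset.sum_fiberwise_of_maps_to (fun a ha ↦ (hP a).mp ha), Finset.card_eq_sum_ones,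
      Finset.sum_mul]
    refine Finset.sum_congr rfl fun b hb ↦ ?_
    have hcard : (P - C b).roots.card = P.natDegree := by
      rw [splits_iff_card_roots.mp (IsAlgClosed.splits (P - C b)), natDegree_sub_C]
    rw [one_mul, ← hcard, ← Multiset.sum_count_eq_card (s := A.filter fun a ↦ P.eval a = b)]
    · refine Finset.sum_congr rfl fun a ha ↦ ?_
      rw [count_roots, (Finset.mem_filter.mp ha).2]
    · intro a ha
      have hab : P.eval a = b := by
        simpa [sub_eq_zero] using (mem_roots (hne b)).mp ha
      exact Finset.mem_filter.mpr ⟨(hP a).mpr (hab ▸ hb), hab⟩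
  have hmult (a : k) :
      (P - C (P.eval a)).rootMultiplicity a ≤ 1 + P.derivative.roots.count a := by
    have hroot : (P - C (P.eval a)).IsRoot a := by simp
    have h := derivative_rootMultiplicity_of_root hroot
    rw [derivative_sub, derivative_C, sub_zero] at h
    rw [count_roots]
    omega
  have hcount : ∑ a ∈ A, P.derivative.roots.count a ≤ P.natDegree - 1 :=
    calc ∑ a ∈ A, P.derivative.roots.count a
        ≤ ∑ a ∈ A ∪ P.derivative.roots.toFinset, P.derivative.roots.count a :=
          Finset.sum_le_sum_of_subset Finset.subset_union_left
      _ = P.derivative.roots.card := Multiset.sum_count_eq_card fun a ha ↦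
          Finset.mem_union_right _ (Multiset.mem_toFinset.mpr ha)
      _ ≤ P.natDegree - 1 := (card_roots' _).trans (natDegree_derivative_le P)
  calc B.card * P.natDegree = ∑ a ∈ A, (P - C (P.eval a)).rootMultiplicity a := hfib.symm
    _ ≤ ∑ a ∈ A, (1 + P.derivative.roots.count a) := Finset.sum_le_sum fun a _ ↦ hmult a
    _ = A.card + ∑ a ∈ A, P.derivative.roots.count a := by
      rw [Finset.sum_add_distrib, ← Finset.card_eq_sum_ones]
    _ ≤ A.card + (P.natDegree - 1) := by gcongr

theorem reduction_between_equinumerous_is_linear {k : Type*} [Field k] [IsAlgClosed k]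
    [CharZero k] (n : ℕ) (hn : 2 ≤ n) (A B : Set k)
    (hA : A.Finite) (hB : B.Finite) (hAn : A.ncard = n) (hBn : B.ncard = n)
    (P : Polynomial k) (hP : A = {x : k | Polynomial.eval x P ∈ B}) :
    P.degree = 1 := by
  have hd : P.natDegree ≠ 0 := by
    intro h
    obtain ⟨c, rfl⟩ := Polynomial.natDegree_eq_zero.mp h
    simp only [Polynomial.eval_C] at hP
    by_cases hc : c ∈ B
    · simp only [hc, Set.ofPred_true] at hP
      exact Set.infinite_univ (hP ▸ hA)
    · simp only [hc, Set.ofPred_false] at hP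
      rw [hP, Set.ncard_empty] at hAn
      omega
  have hle := card_mul_natDegree_le_of_preimage_eq hA.toFinset hB.toFinset P hd fun x ↦ by
    rw [hA.mem_toFinset, hB.mem_toFinset]
    exact Set.ext_iff.mp hP x
  rw [← Set.ncard_eq_toFinset_card A hA, ← Set.ncard_eq_toFinset_card B hB, hAn, hBn] at hle
  refine (Polynomial.degree_eq_iff_natDegree_eq_of_pos one_pos).mpr ?_
  obtain ⟨e, he⟩ := Nat.exists_eq_succ_of_ne_zero hd
  rw [he] at hle ⊢
  simp only [Nat.succ_eq_add_one, Nat.add_sub_cancel] at hle ⊢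
  nlinarith
end

section
/- Let k be an algebraically closed field of characteristic 0 and let A, B ⊆ k be finite sets with the same number of elements. If A ≤_p B, then also B ≤_p A; that is, A ≡_p B. -/
open Pointwise

open Polynomial in
/-- Riemann–Hurwitz bound for polynomials: if `P` is nonconstant and all fibres over `T` lie in `S`,
then `#T * deg P + 1 ≤ #S + deg P`. -/
theorem Polynomial.card_mul_natDegree_add_one_le {k : Type*} [Field k] [IsAlgClosed k] [CharZero k]
    (P : k[X]) (hP : P.natDegree ≠ 0) (S T : Finset k)
    (hST : ∀ x, P.eval x ∈ T → x ∈ S) :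
    T.card * P.natDegree + 1 ≤ S.card + P.natDegree := by
  classical
  have hsub (b : k) : P - C b ≠ 0 := by
    intro h
    rw [sub_eq_zero.mp h, natDegree_C] at hP
    exact hP rfl
  have hfib : ∀ b ∈ T, P.natDegree = ∑ x ∈ S, (P - C b).roots.count x := by
    intro b hb
    rw [Multiset.sum_count_eq_card, ← (IsAlgClosed.splits (P - C b)).natDegree_eq_card_roots,
      natDegree_sub_C]
    intro x hx
    apply hST
    have hroot := (mem_roots'.mp hx).2
    rw [IsRoot, eval_sub, eval_C, sub_eq_zero] at hroot
    rwa [hroot]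
  have hpoint : ∀ x ∈ S, ∑ b ∈ T, (P - C b).roots.count x ≤ 1 + P.derivative.roots.count x := by
    intro x _
    have hle (b : k) (hb : b ∈ T) : (P - C b).roots.count x ≤
        if P.eval x = b then 1 + P.derivative.roots.count x else 0 := by
      split_ifs with h
      · have hr : (P - C b).IsRoot x := by simp [h]
        have hd := derivative_rootMultiplicity_of_root hr
        rw [derivative_sub, derivative_C, sub_zero] at hd
        rw [count_roots, count_roots]
        lia
      · rw [count_roots, Nat.le_zero, rootMultiplicity_eq_zero]
        simpa [sub_eq_zero] using h
    refine (Finset.sum_le_sum hle).trans ?_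
    rw [Finset.sum_ite_eq]
    split_ifs <;> simp
  have hder : ∑ x ∈ S, P.derivative.roots.count x ≤ P.natDegree - 1 := by
    calc ∑ x ∈ S, P.derivative.roots.count x
        ≤ P.derivative.roots.card := by
          rw [← Multiset.sum_count_eq_card (s := S ∪ P.derivative.roots.toFinset)
            (by simp +contextual)]
          exact Finset.sum_le_sum_of_subset Finset.subset_union_left
      _ ≤ P.derivative.natDegree := card_roots' _
      _ ≤ P.natDegree - 1 := natDegree_derivative_le P
  have htotal : T.card * P.natDegree ≤ S.card + (P.natDegree - 1) := by
    calc T.card * P.natDegree = ∑ b ∈ T, ∑ x ∈ S, (P - C b).roots.count x := by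
          rw [← Finset.sum_congr rfl hfib, Finset.sum_const, smul_eq_mul]
      _ = ∑ x ∈ S, ∑ b ∈ T, (P - C b).roots.count x := Finset.sum_comm
      _ ≤ ∑ x ∈ S, (1 + P.derivative.roots.count x) := Finset.sum_le_sum hpoint
      _ ≤ S.card + (P.natDegree - 1) := by
          rw [Finset.sum_add_distrib, Finset.sum_const, smul_eq_mul, mul_one]
          gcongr
  lia

open Polynomial in
/-- A reduction through a polynomial of degree one can be reversed. -/
theorem PolyRed.symm_of_natDegree_eq_one {k : Type*} [Field k] {A B : Set k} {P : k[X]}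
    (hP : P.natDegree = 1) (h : A = {x : k | P.eval x ∈ B}) : PolyRed B A := by
  obtain ⟨a, ha, b, rfl⟩ := natDegree_eq_one.mp hP
  refine ⟨C a⁻¹ * (X - C b), ?_⟩
  ext x
  simp [h, ha]

theorem polyRed_iff_polyEquiv_of_same_card {k : Type*} [Field k] [IsAlgClosed k]
    [CharZero k] (A B : Set k) (hA : A.Finite) (hB : B.Finite)
    (hcard : A.ncard = B.ncard) (h : PolyRed A B) :
    PolyEquiv A B := by
  refine ⟨h, ?_⟩
  obtain ⟨P, hP⟩ := h
  rcases Nat.lt_or_ge 1 A.ncard with hn | hn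
  · have hdeg : P.natDegree ≠ 0 := by
      intro hd
      obtain ⟨c, rfl⟩ := Polynomial.natDegree_eq_zero.mp hd
      by_cases hc : c ∈ B
      · have hu : A = Set.univ := by simp [hP, hc]
        exact Set.infinite_univ (hu ▸ hA)
      · have he : A = ∅ := by simp [hP, hc]
        simp [he] at hn
    have hbound := P.card_mul_natDegree_add_one_le hdeg hA.toFinset hB.toFinset (by simp [hP])
    rw [← Set.ncard_eq_toFinset_card A hA, ← Set.ncard_eq_toFinset_card B hB, ← hcard] at hbound
    refine PolyRed.symm_of_natDegree_eq_one ?_ hP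
    by_contra hne
    have h2 : 2 ≤ P.natDegree := by lia
    nlinarith
  · rcases Nat.le_one_iff_eq_zero_or_eq_one.mp hn with h0 | h1
    · rw [(Set.ncard_eq_zero hA).mp h0, (Set.ncard_eq_zero hB).mp (hcard ▸ h0)]
      exact ⟨Polynomial.X, by simp⟩
    · obtain ⟨a, rfl⟩ := Set.ncard_eq_one.mp h1
      obtain ⟨b, rfl⟩ := Set.ncard_eq_one.mp (hcard ▸ h1)
      refine ⟨Polynomial.X + Polynomial.C (a - b), ?_⟩
      ext x
      simp only [Set.mem_singleton_iff, Set.mem_ofPred_eq, Polynomial.eval_add, Polynomial.eval_X,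
        Polynomial.eval_C]
      grind
end

section
/- Let k be an algebraically closed field of characteristic 0, let B ⊆ k be finite with |B| = n, and let f(x) = c·x + c' (c ≠ 0) be an affine map with f(B) = B whose restriction to B is not the identity. Then there exists r ≥ 2 such that c is a primitive r-th root of unity, every orbit of f contained in B of size greater than 1 has exactly r elements, and at most one element of B is a fixed point of f; consequently, if s is the number of r-element orbits of f in B, then n = s·r or n = s·r + 1. -/
open Pointwise

/-- The forward orbit of `x` under the homothety `y ↦ a + c * (y - a)`. -/
def homothetyOrbit {k : Type*} [Field k] (a c x : k) : Set k :=
  {y | ∃ j : ℕ, a + c ^ j * (x - a) = y}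

theorem affine_iterate_eq {k : Type*} [Field k] {a c c' : k} (ha : c * a + c' = a) (x : k)
    (j : ℕ) : (fun x : k => c * x + c')^[j] x = a + c ^ j * (x - a) := by
  induction j with
  | zero => simp
  | succ j ih =>
    rw [Function.iterate_succ_apply', ih]
    linear_combination ha

theorem mem_homothetyOrbit_self {k : Type*} [Field k] (a c x : k) :
    x ∈ homothetyOrbit a c x := ⟨0, by ring⟩

theorem homothetyOrbit_subset_of_mem {k : Type*} [Field k] {a c x y : k}
    (h : y ∈ homothetyOrbit a c x) : homothetyOrbit a c y ⊆ homothetyOrbit a c x := by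
  obtain ⟨j, rfl⟩ := h
  rintro _ ⟨i, rfl⟩
  exact ⟨i + j, by ring⟩

theorem mem_homothetyOrbit_symm {k : Type*} [Field k] {a c x y : k} {r : ℕ} (hr : 0 < r)
    (hc : c ^ r = 1) (h : y ∈ homothetyOrbit a c x) : x ∈ homothetyOrbit a c y := by
  obtain ⟨j, rfl⟩ := h
  refine ⟨r * j - j, ?_⟩
  have hpow : c ^ (r * j - j) * c ^ j = 1 := by
    rw [← pow_add, Nat.sub_add_cancel (Nat.le_mul_of_pos_left j hr), pow_mul, hc, one_pow]
  linear_combination (x - a) * hpow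

theorem homothetyOrbit_eq_iff {k : Type*} [Field k] {a c x y : k} {r : ℕ} (hr : 0 < r)
    (hc : c ^ r = 1) : homothetyOrbit a c y = homothetyOrbit a c x ↔ y ∈ homothetyOrbit a c x :=
  ⟨fun h => h ▸ mem_homothetyOrbit_self a c y, fun h =>
    (homothetyOrbit_subset_of_mem h).antisymm
      (homothetyOrbit_subset_of_mem (mem_homothetyOrbit_symm hr hc h))⟩

theorem homothetyOrbit_self {k : Type*} [Field k] (a c : k) : homothetyOrbit a c a = {a} := by
  ext y
  simp [homothetyOrbit, eq_comm]

theorem ncard_homothetyOrbit {k : Type*} [Field k] {a c x : k} {r : ℕ} (hr : 0 < r)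
    (hc : IsPrimitiveRoot c r) (hx : x ≠ a) : (homothetyOrbit a c x).ncard = r := by
  classical
  have himage : homothetyOrbit a c x =
      ((Finset.range r).image fun j => a + c ^ j * (x - a) : Finset k) := by
    ext y
    simp only [homothetyOrbit, Set.mem_ofPred_eq, Finset.coe_image, Set.mem_image,
      Finset.coe_range, Set.mem_Iio]
    constructor
    · rintro ⟨j, rfl⟩
      exact ⟨j % r, Nat.mod_lt _ hr, by rw [← pow_eq_pow_mod j hc.pow_eq_one]⟩
    · rintro ⟨j, -, rfl⟩
      exact ⟨j, rfl⟩
  rw [himage, Set.ncard_coe_finset, Finset.card_image_of_injOn, Finset.card_range]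
  intro i hi j hj hij
  exact hc.pow_inj (by simpa using hi) (by simpa using hj)
    (mul_right_cancel₀ (sub_ne_zero.mpr hx) (add_left_cancel hij))

/-- A finite set stable under a homothety of order `r`, minus the centre, is a disjoint union of
orbits of size `r`. -/
theorem ncard_diff_eq_ncard_homothetyOrbits_mul {k : Type*} [Field k] {a c : k} {r : ℕ}
    {B : Set k} (hB : B.Finite) (hr : 2 ≤ r) (hc : IsPrimitiveRoot c r)
    (hsub : ∀ b ∈ B, homothetyOrbit a c b ⊆ B) :
    (B \ {a}).ncard =
      {O : Set k | ∃ b ∈ B, O = homothetyOrbit a c b ∧ O.ncard = r}.ncard * r := by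
  classical
  have hr0 : 0 < r := by omega
  have hfin : (B \ {a}).Finite := hB.sdiff
  have horbits : {O : Set k | ∃ b ∈ B, O = homothetyOrbit a c b ∧ O.ncard = r} =
      (hfin.toFinset.image (homothetyOrbit a c) : Finset (Set k)) := by
    ext O
    simp only [Set.mem_ofPred_eq, Finset.coe_image, Set.Finite.coe_toFinset, Set.mem_image]
    constructor
    · rintro ⟨b, hb, rfl, hcard⟩
      refine ⟨b, ⟨hb, ?_⟩, rfl⟩
      rintro rfl
      rw [homothetyOrbit_self, Set.ncard_singleton] at hcard
      omega
    · rintro ⟨b, ⟨hb, hba⟩, rfl⟩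
      exact ⟨b, hb, rfl, ncard_homothetyOrbit hr0 hc hba⟩
  rw [horbits, Set.ncard_coe_finset, Set.ncard_eq_toFinset_card _ hfin,
    Finset.card_eq_sum_card_image (homothetyOrbit a c), Finset.sum_const_nat]
  intro O hO
  obtain ⟨b, hb, rfl⟩ := Finset.mem_image.mp hO
  obtain ⟨hb, hba⟩ := hfin.mem_toFinset.mp hb
  rw [← ncard_homothetyOrbit hr0 hc hba, ← Set.ncard_coe_finset]
  congr 1
  ext y
  simp only [Finset.coe_filter, Set.Finite.mem_toFinset, Set.mem_ofPred_eq,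
    homothetyOrbit_eq_iff hr0 hc.pow_eq_one]
  refine ⟨fun h => h.2, fun h => ⟨⟨hsub b hb h, ?_⟩, h⟩⟩
  rintro rfl
  have := mem_homothetyOrbit_symm hr0 hc.pow_eq_one h
  rw [homothetyOrbit_self] at this
  exact hba this

theorem ne_one_of_affine_mapsTo {k : Type*} [Field k] [CharZero k] {B : Set k} (hB : B.Finite)
    {c c' b : k} (hmaps : Set.MapsTo (fun x : k => c * x + c') B B) (hb : b ∈ B)
    (hne : c * b + c' ≠ b) : c ≠ 1 := by
  rintro rfl
  have hc' : c' ≠ 0 := by simpa using hne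
  have hiter (j : ℕ) : (fun x : k => 1 * x + c')^[j] b = b + j * c' := by
    induction j with
    | zero => simp
    | succ j ih =>
      rw [Function.iterate_succ_apply', ih]
      push_cast
      ring
  refine Set.infinite_of_injective_forall_mem (f := fun j : ℕ => b + j * c') ?_ ?_ hB
  · intro i j hij
    exact Nat.cast_injective (mul_right_cancel₀ hc' (add_left_cancel hij))
  · intro j
    rw [← hiter]
    exact hmaps.iterate j hb

theorem isOfFinOrder_of_homothetyOrbit_finite {k : Type*} [Field k] {a c x : k}
    (hc : c ≠ 0) (hx : x ≠ a) (hfin : (homothetyOrbit a c x).Finite) : IsOfFinOrder c := by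
  have hninj : ¬ Function.Injective fun j : ℕ => a + c ^ j * (x - a) := fun hinj =>
    Set.infinite_of_injective_forall_mem (s := homothetyOrbit a c x) hinj (fun j => ⟨j, rfl⟩) hfin
  simp only [Function.Injective, not_forall] at hninj
  obtain ⟨i, j, hij, hne⟩ := hninj
  have hpow : c ^ i = c ^ j := mul_right_cancel₀ (sub_ne_zero.mpr hx) (add_left_cancel hij)
  wlog hlt : i < j generalizing i j
  · exact this j i hij.symm (Ne.symm hne) hpow.symm (by omega)
  refine isOfFinOrder_iff_pow_eq_one.mpr ⟨j - i, by omega, ?_⟩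
  apply mul_right_cancel₀ (pow_ne_zero i hc)
  rw [← pow_add, Nat.sub_add_cancel hlt.le, one_mul, hpow]

theorem affine_stabilising_map_orbit_structure {k : Type*} [Field k] [IsAlgClosed k]
    [CharZero k] (n : ℕ) (B : Set k) (hB : B.Finite) (hcard : B.ncard = n)
    (c c' : k) (hc : c ≠ 0) (hmap : (fun x : k => c * x + c') '' B = B)
    (hnid : ∃ b ∈ B, c * b + c' ≠ b) :
    ∃ r : ℕ, 2 ≤ r ∧ IsPrimitiveRoot c r ∧
      (∀ b ∈ B, 1 < {x : k | ∃ j : ℕ, (fun x : k => c * x + c')^[j] b = x}.ncard →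
        {x : k | ∃ j : ℕ, (fun x : k => c * x + c')^[j] b = x}.ncard = r) ∧
      (∀ b ∈ B, ∀ b' ∈ B, c * b + c' = b → c * b' + c' = b' → b = b') ∧
      (∀ s : ℕ,
        s = {O : Set k | ∃ b ∈ B,
              O = {x : k | ∃ j : ℕ, (fun x : k => c * x + c')^[j] b = x} ∧
              O.ncard = r}.ncard →
        n = s * r ∨ n = s * r + 1) := by
  obtain ⟨b₀, hb₀, hne₀⟩ := hnid
  have hmaps : Set.MapsTo (fun x : k => c * x + c') B B := Set.mapsTo_iff_image_subset.mpr hmap.le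
  have hc1 : 1 - c ≠ 0 := sub_ne_zero.mpr (ne_one_of_affine_mapsTo hB hmaps hb₀ hne₀).symm
  obtain ⟨a, ha⟩ : ∃ a, c * a + c' = a := ⟨c' / (1 - c), by field_simp; ring⟩
  have horbit (b : k) :
      {x : k | ∃ j : ℕ, (fun x : k => c * x + c')^[j] b = x} = homothetyOrbit a c b := by
    simp only [affine_iterate_eq ha, homothetyOrbit]
  have hsub (b : k) (hb : b ∈ B) : homothetyOrbit a c b ⊆ B := by
    rw [← horbit]
    rintro _ ⟨j, rfl⟩
    exact hmaps.iterate j hb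
  have hb₀a : b₀ ≠ a := by
    rintro rfl
    exact hne₀ ha
  have hfinOrder : IsOfFinOrder c :=
    isOfFinOrder_of_homothetyOrbit_finite hc hb₀a (hB.subset (hsub b₀ hb₀))
  have hprim := IsPrimitiveRoot.orderOf c
  have hpos := hfinOrder.orderOf_pos
  have hr : 2 ≤ orderOf c := by
    have : orderOf c ≠ 1 := fun h => hc1 (by rw [orderOf_eq_one_iff.mp h, sub_self])
    omega
  refine ⟨orderOf c, hr, hprim, ?_, ?_, ?_⟩
  · intro b _ hb1
    rw [horbit] at hb1 ⊢
    refine ncard_homothetyOrbit hpos hprim ?_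
    rintro rfl
    simp [homothetyOrbit_self] at hb1
  · intro b _ b' _ h h'
    exact mul_left_cancel₀ hc1 (by linear_combination h' - h)
  · rintro s rfl
    simp only [horbit]
    rw [← ncard_diff_eq_ncard_homothetyOrbits_mul hB hr hprim hsub, ← hcard]
    by_cases haB : a ∈ B
    · exact Or.inr (Set.ncard_sdiff_singleton_add_one haB hB).symm
    · exact Or.inl (by rw [Set.sdiff_singleton_eq_self haB])
end

section
/- Let k be an algebraically closed field of characteristic 0 and let B ⊆ k be finite with |B| = n ≥ 2. Consider the group of affine equivalences of k (invertible maps x ↦ c·x + c' with c ≠ 0) acting pointwise on subsets of k, and let H be the stabilizer subgroup of B under this action. Then H is a cyclic group, and its cardinality divides n or divides n − 1. -/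
open Pointwise

noncomputable instance {k : Type*} [Field k] : MulAction (k ≃ᵃ[k] k) k where
  smul f x := f x
  one_smul _ := rfl
  mul_smul _ _ _ := rfl

theorem AffineEquiv.apply_eq_linear_one_mul_add {k : Type*} [Field k] (g : k ≃ᵃ[k] k) (c x : k) :
    g x = g.linear 1 * (x - c) + g c := by
  have h := g.map_vadd c (x - c)
  have h2 : g.linear (x - c) = (x - c) * g.linear 1 := by
    simpa using g.linear.map_smul (x - c) 1
  simp only [vadd_eq_add, sub_add_cancel] at h
  rw [h, h2, mul_comm]

/-- An affine equivalence of `k` preserving a nonempty finite set fixes its barycentre. -/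
theorem AffineEquiv.apply_barycentre {k : Type*} [Field k] [CharZero k] (s : Finset k)
    (hs : s.Nonempty) (g : k ≃ᵃ[k] k) (hg : g '' (s : Set k) = s) :
    g ((∑ b ∈ s, b) / s.card) = (∑ b ∈ s, b) / s.card := by
  classical
  have himage : s.image g = s := by
    rw [← Finset.coe_inj, Finset.coe_image, hg]
  have hcard : (s.card : k) ≠ 0 := by exact_mod_cast hs.card_pos.ne'
  have hsum : ∑ b ∈ s, g b = ∑ b ∈ s, b := by
    conv_rhs => rw [← himage]
    rw [Finset.sum_image g.injective.injOn]
  rw [Finset.sum_congr rfl fun b _ => g.apply_eq_linear_one_mul_add 0 b,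
    Finset.sum_add_distrib, ← Finset.mul_sum] at hsum
  rw [g.apply_eq_linear_one_mul_add 0]
  simp only [sub_zero, Finset.sum_const, nsmul_eq_mul] at hsum ⊢
  field_simp
  linear_combination hsum

/-- The linear part, as a homomorphism from affine equivalences of `k` to the scalars. -/
def AffineEquiv.linearCoeff (k : Type*) [Field k] : (k ≃ᵃ[k] k) →* k where
  toFun g := g.linear 1
  map_one' := rfl
  map_mul' g h := by
    change g.linear (h.linear 1) = _
    simpa [mul_comm] using g.linear.map_smul (h.linear 1) 1

/-- The cardinality of a group acting freely divides that of the set. -/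
theorem MulAction.natCard_dvd_of_stabilizer_eq_bot {G X : Type*} [Group G] [MulAction G X]
    (h : ∀ x : X, stabilizer G x = ⊥) : Nat.card G ∣ Nat.card X := by
  rw [Nat.card_congr (selfEquivOrbitsQuotientProd h), Nat.card_prod]
  exact dvd_mul_left _ _

theorem stabilizer_cyclic_of_finite_set {k : Type*} [Field k] [IsAlgClosed k]
    [CharZero k] (n : ℕ) (hn : 2 ≤ n) (B : Set k) (hB : B.Finite) (hcard : B.ncard = n) :
    IsCyclic (MulAction.stabilizer (k ≃ᵃ[k] k) B) ∧
      (Nat.card (MulAction.stabilizer (k ≃ᵃ[k] k) B) ∣ n ∨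
        Nat.card (MulAction.stabilizer (k ≃ᵃ[k] k) B) ∣ n - 1) := by
  obtain ⟨c, hc⟩ : ∃ c : k, ∀ g ∈ MulAction.stabilizer (k ≃ᵃ[k] k) B, g c = c := by
    lift B to Finset k using hB
    rw [Set.ncard_coe_finset] at hcard
    exact ⟨_, fun g hg => g.apply_barycentre B (Finset.card_pos.1 (by omega)) hg⟩
  set H := MulAction.stabilizer (k ≃ᵃ[k] k) B
  have hinj : Function.Injective ((AffineEquiv.linearCoeff k).comp H.subtype) := by
    intro g h hgh
    replace hgh : g.1.linear 1 = h.1.linear 1 := hgh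
    ext x
    rw [g.1.apply_eq_linear_one_mul_add c, h.1.apply_eq_linear_one_mul_add c, hgh,
      hc _ g.2, hc _ h.2]
  let S : SubMulAction H k :=
    { carrier := B \ {c}
      smul_mem' := by
        rintro g x ⟨hxB, hxc⟩
        refine ⟨?_, fun hx => hxc (g.1.injective ?_)⟩
        · have hg : g.1 '' B = B := g.2
          exact hg.subset (Set.mem_image_of_mem g.1 hxB)
        · exact Eq.trans hx (hc _ g.2).symm }
  have hfree (x : S) : MulAction.stabilizer H x = ⊥ := by
    refine (Subgroup.eq_bot_iff_forall _).2 fun g hg => hinj ?_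
    have hgx : g.1 x = x := congrArg Subtype.val (MulAction.mem_stabilizer_iff.1 hg)
    have hxc : (x : k) - c ≠ 0 := sub_ne_zero.2 x.2.2
    rw [g.1.apply_eq_linear_one_mul_add c, hc _ g.2] at hgx
    rw [map_one]
    change g.1.linear 1 = 1
    exact mul_right_cancel₀ hxc (by linear_combination hgx)
  have hcardS : Nat.card S = n ∨ Nat.card S = n - 1 := by
    change (B \ {c}).ncard = n ∨ (B \ {c}).ncard = n - 1
    by_cases hcB : c ∈ B
    · exact .inr (by rw [Set.ncard_sdiff_singleton_of_mem hcB, hcard])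
    · exact .inl (by rw [Set.sdiff_singleton_eq_self hcB, hcard])
  have hdvd := MulAction.natCard_dvd_of_stabilizer_eq_bot hfree
  have : Finite H := Nat.finite_of_card_ne_zero <|
    ne_zero_of_dvd_ne_zero (by omega) hdvd
  exact ⟨isCyclic_of_injective_ringHom _ hinj,
    hcardS.imp (fun h : _ = n => h ▸ hdvd) (fun h : _ = n - 1 => h ▸ hdvd)⟩
end

section
/- Let k be an algebraically closed field of characteristic 0, let 2 ≤ n < m, and let A, B ⊆ k be finite sets with |A| = m and |B| = n. Then the set of polynomials P ∈ k[X] such that A = {x ∈ k | P(x) ∈ B} is finite. -/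
open Pointwise

open Polynomial UniqueFactorizationMonoid in
theorem natDegree_radical_le_card_roots_toFinset {k : Type*} [Field k] [IsAlgClosed k]
    [DecidableEq k] {p : k[X]} (hp : p ≠ 0) :
    (radical p).natDegree ≤ p.roots.toFinset.card := by
  have hsep : (radical p).Separable :=
    PerfectField.separable_iff_squarefree.mpr squarefree_radical
  rw [(IsAlgClosed.splits (radical p)).natDegree_eq_card_roots,
    ← Multiset.toFinset_card_of_nodup (nodup_roots hsep)]
  exact Finset.card_le_card
    (Multiset.toFinset_subset.mpr (Multiset.subset_of_le (roots.le_of_dvd hp radical_dvd_self)))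

open Polynomial in
/-- A consequence of the polynomial ABC theorem: if the preimage under a polynomial `P` of a
set with at least two points is finite and nonempty, then it has more than `deg P` points. -/
theorem natDegree_lt_ncard_of_eval_preimage {k : Type*} [Field k] [IsAlgClosed k] [CharZero k]
    {A B : Set k} (hA : A.Finite) (hA₀ : A.Nonempty) (hB : B.Nontrivial) {P : k[X]}
    (hP : A = {x : k | P.eval x ∈ B}) : P.natDegree < A.ncard := by
  classical
  have hpos : 0 < A.ncard := (Set.ncard_pos hA).mpr hA₀
  obtain ⟨b, hb, c, hc, hbc⟩ := hB
  rcases Nat.eq_zero_or_pos P.natDegree with h0 | hdeg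
  · omega
  have hne : ∀ t : k, P - C t ≠ 0 := fun t h => by
    rw [sub_eq_zero.mp h, natDegree_C] at hdeg
    exact hdeg.ne rfl
  have hu : b - c ≠ 0 := sub_ne_zero.mpr hbc
  have hcop : IsCoprime (P - C b) (-(P - C c)) := by
    refine IsCoprime.neg_right ⟨-C (b - c)⁻¹, C (b - c)⁻¹, ?_⟩
    have : (C (b - c)⁻¹ : k[X]) * C (b - c) = 1 := by
      rw [← C_mul, inv_mul_cancel₀ hu, C_1]
    rw [← this, C_sub]
    ring
  have hnz := mul_ne_zero (mul_ne_zero (hne b) (neg_ne_zero.mpr (hne c))) (C_ne_zero.mpr hu)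
  rcases Polynomial.abc (hne b) (neg_ne_zero.mpr (hne c)) (C_ne_zero.mpr hu) hcop
      (by rw [C_sub]; ring) with ⟨h, -, -⟩ | ⟨h, -, -⟩
  · rw [natDegree_sub_C] at h
    refine Nat.lt_of_succ_le (h.trans ((natDegree_radical_le_card_roots_toFinset hnz).trans ?_))
    rw [← Set.ncard_coe_finset]
    refine Set.ncard_le_ncard (fun x hx => ?_) hA
    have hx' : (P.eval x = b ∨ P.eval x = c) := by
      have hx₀ := (mem_roots'.mp (Multiset.mem_toFinset.mp hx)).2
      simpa only [IsRoot.def, eval_mul, eval_neg, eval_sub, eval_C, mul_eq_zero, hu, or_false,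
        neg_eq_zero, sub_eq_zero] using hx₀
    rw [hP]
    rcases hx' with h | h <;> simpa [h]
  · have := derivative_eq_zero.mp h
    rw [natDegree_sub_C] at this
    omega

theorem finitely_many_reducing_polynomials {k : Type*} [Field k] [IsAlgClosed k]
    [CharZero k] (n m : ℕ) (hn : 2 ≤ n) (hnm : n < m) (A B : Set k)
    (hA : A.Finite) (hB : B.Finite) (hAm : A.ncard = m) (hBn : B.ncard = n) :
    {P : Polynomial k | A = {x : k | Polynomial.eval x P ∈ B}}.Finite := by
  have hA₀ : A.Nonempty := (Set.ncard_pos hA).mp (by omega)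
  have : Finite B := hB
  have hB₂ : B.Nontrivial := Set.one_lt_ncard_iff_nontrivial.mp (by omega)
  have : Fintype A := hA.fintype
  refine Set.Finite.of_injOn (f := fun P (a : A) => P.eval (a : k))
    (t := Set.univ.pi fun _ => B) ?_ ?_ (Set.Finite.pi fun _ => hB)
  · intro P hP a _
    exact hP.subset a.2
  · intro P hP Q hQ hPQ
    have hdP := natDegree_lt_ncard_of_eval_preimage hA hA₀ hB₂ hP
    have hdQ := natDegree_lt_ncard_of_eval_preimage hA hA₀ hB₂ hQ
    rw [Set.ncard_eq_toFinset_card' A, Set.toFinset_card] at hdP hdQ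
    exact Polynomial.eq_of_natDegree_lt_card_of_eval_eq P Q Subtype.val_injective
      (congrFun hPQ) (max_lt hdP hdQ)
end

section
/- Let k be an algebraically closed field of characteristic 0 and let A ⊆ k be finite and nonempty. Then there exists a finite collection 𝒮 of subsets of k such that for every B ⊆ k with A ≤_p B there is C ∈ 𝒮 with B ≡_p C. In other words, only finitely many polynomial bireducibility classes lie above the class of A. -/
open Pointwise

open Polynomial in
/-- If two distinct fibres of a nonconstant polynomial lie in a finite set, then the degree is less
than the size of that set. This is a consequence of the Mason–Stothers theorem. -/
theorem natDegree_lt_card_of_fibres_subset {k : Type*} [Field k] [IsAlgClosed k] [CharZero k]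
    {P : k[X]} (hP : P.natDegree ≠ 0) {s : Finset k} {β γ : k} (hβγ : β ≠ γ)
    (hβ : ∀ x, P.eval x = β → x ∈ s) (hγ : ∀ x, P.eval x = γ → x ∈ s) :
    P.natDegree < s.card := by
  classical
  have hdeg (c : k) : (P - C c).natDegree = P.natDegree := natDegree_sub_C
  have hne (c : k) : P - C c ≠ 0 := fun h ↦ hP <| by rw [← hdeg c, h, natDegree_zero]
  have hu : IsUnit (C (β - γ)) := isUnit_C.2 (sub_ne_zero.2 hβγ).isUnit
  have hcop : IsCoprime (P - C β) (-(P - C γ)) := by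
    obtain ⟨v, hv⟩ := hu.exists_left_inv
    refine ⟨-v, -v, ?_⟩
    rw [← hv, C_sub]
    ring
  have hsum : (P - C β) + -(P - C γ) + C (β - γ) = 0 := by
    rw [C_sub]
    ring
  have habc : (P - C β) * -(P - C γ) * C (β - γ) ≠ 0 :=
    mul_ne_zero (mul_ne_zero (hne β) (neg_ne_zero.2 (hne γ))) hu.ne_zero
  have hrad := UniqueFactorizationMonoid.radical_dvd_self
    (a := (P - C β) * -(P - C γ) * C (β - γ))
  set R := UniqueFactorizationMonoid.radical ((P - C β) * -(P - C γ) * C (β - γ))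
  have hRsq : Squarefree R := UniqueFactorizationMonoid.squarefree_radical
  have hRs : R.natDegree ≤ s.card := by
    rw [(IsAlgClosed.splits R).natDegree_eq_card_roots]
    have hnd : R.roots.Nodup := nodup_roots (PerfectField.separable_iff_squarefree.2 hRsq)
    rw [← Multiset.toFinset_card_of_nodup hnd]
    refine Finset.card_le_card fun x hx ↦ ?_
    have hx' := (isRoot_of_mem_roots (Multiset.mem_toFinset.1 hx)).dvd hrad
    simp only [IsRoot.def, eval_mul, eval_neg, eval_sub, eval_C, mul_eq_zero, neg_eq_zero,
      sub_eq_zero, hβγ, or_false] at hx'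
    exact hx'.elim (hβ x) (hγ x)
  rcases Polynomial.abc (hne β) (neg_ne_zero.2 (hne γ)) hu.ne_zero hcop hsum with h | h
  · have := h.1
    rw [hdeg] at this
    exact lt_of_lt_of_le this hRs
  · exact absurd (hdeg β ▸ derivative_eq_zero.1 h.1) hP

open Polynomial in
/-- A set is bireducible with its image under a bijective affine map. -/
theorem polyEquiv_image_affine {k : Type*} [Field k] (B : Set k) {c : k} (hc : c ≠ 0) (β : k) :
    PolyEquiv B ((fun y ↦ c⁻¹ * (y - β)) '' B) := by
  refine ⟨⟨C c⁻¹ * (X - C β), ?_⟩, ⟨C c * X + C β, ?_⟩⟩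
  · ext y
    simp [hc]
  · ext z
    simp only [Set.mem_image, Set.mem_ofPred_eq, eval_add, eval_mul, eval_C, eval_X]
    constructor
    · rintro ⟨y, hy, rfl⟩
      simpa [hc] using hy
    · exact fun h ↦ ⟨_, h, by simp [hc]⟩

theorem finitely_many_classes_above {k : Type*} [Field k] [IsAlgClosed k]
    [CharZero k] (A : Set k) (hA : A.Finite) (hne : A.Nonempty) :
    ∃ S : Set (Set k), S.Finite ∧
      ∀ B : Set k, PolyRed A B → ∃ C ∈ S, PolyEquiv B C := by
  classical
  open Polynomial in
  set s := hA.toFinset with hs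
  refine ⟨insert {0} ((fun m : Multiset k ↦ (fun x ↦ ((m.map fun a ↦ X - C a).prod).eval x) '' A) ''
    Set.Iic (s.card • s.val)), ((Set.finite_Iic _).image _).insert _, ?_⟩
  rintro B ⟨P, hP⟩
  have hmem (x : k) : x ∈ A ↔ P.eval x ∈ B := by rw [hP]; rfl
  have hdeg : P.natDegree ≠ 0 := by
    intro h
    rw [natDegree_eq_zero] at h
    obtain ⟨c, rfl⟩ := h
    obtain ⟨a, ha⟩ := hne
    have : A = Set.univ := Set.eq_univ_of_forall fun x ↦ by simpa [hmem] using ha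
    exact Set.infinite_univ (this ▸ hA)
  have hsurj (y : k) : ∃ x, P.eval x = y :=
    IsAlgClosed.eval_surjective (by simpa [degree_eq_natDegree] using hdeg) y
  obtain ⟨a, ha⟩ := hne
  obtain ⟨β, hβ⟩ : ∃ β, β ∈ B := ⟨_, (hmem a).1 ha⟩
  by_cases hB : ∃ γ ∈ B, β ≠ γ
  · obtain ⟨γ, hγ, hβγ⟩ := hB
    have hfib {c : k} (hc : c ∈ B) (x : k) (hx : P.eval x = c) : x ∈ s := by
      simpa [hs, hmem, hx] using hc
    have hlt := natDegree_lt_card_of_fibres_subset hdeg hβγ (hfib hβ) (hfib hγ)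
    have hdegβ : (P - C β).natDegree = P.natDegree := natDegree_sub_C
    have hc : (P - C β).leadingCoeff ≠ 0 := leadingCoeff_ne_zero.2 fun h ↦ hdeg <| by
      rw [← hdegβ, h, natDegree_zero]
    refine ⟨_, Or.inr ⟨(P - C β).roots, ?_, rfl⟩, ?_⟩
    · rw [Set.mem_Iic, Multiset.le_iff_count]
      intro x
      by_cases hx : x ∈ (P - C β).roots
      · have hxs : x ∈ s := hfib hβ x <| by
          simpa [sub_eq_zero] using isRoot_of_mem_roots hx
        rw [Multiset.count_nsmul, Multiset.count_eq_one_of_mem s.nodup hxs, mul_one]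
        exact (Multiset.count_le_card _ _).trans ((card_roots' _).trans (hdegβ ▸ hlt.le))
      · simp [Multiset.count_eq_zero_of_notMem hx]
    · have hprod := (IsAlgClosed.splits (P - C β)).eq_prod_roots
      convert polyEquiv_image_affine B hc β using 1
      have hBA : B = (fun x ↦ P.eval x) '' A := by
        ext y
        constructor
        · intro hy
          obtain ⟨x, rfl⟩ := hsurj y
          exact ⟨x, (hmem x).2 hy, rfl⟩
        · rintro ⟨x, hx, rfl⟩
          exact (hmem x).1 hx
      rw [hBA, Set.image_image]
      refine Set.image_congr fun x _ ↦ ?_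
      have := congrArg (eval x) hprod
      rw [eval_mul, eval_C, eval_sub, eval_C] at this
      rw [this, inv_mul_cancel_left₀ hc]
  · have hB' : B = {β} := by
      push Not at hB
      exact Set.eq_singleton_iff_unique_mem.2 ⟨hβ, fun y hy ↦ (hB y hy).symm⟩
    refine ⟨_, Or.inl rfl, ?_⟩
    simpa [hB'] using polyEquiv_image_affine B one_ne_zero β
end

section
/- Let k be an algebraically closed field of characteristic 0, let B ⊆ k be finite and nonempty, and let A ⊆ k and P ∈ k[X] be such that P has degree 2 and A = {x ∈ k | P(x) ∈ B}. Then there exists an affine map g(x) = c·x + c' (c ≠ 0), different from the identity, such that g ∘ g is the identity and g(A) = A; in particular, the stabilizer of A in the group of affine equivalences of k has even order. -/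
open Pointwise

open Polynomial in
/-- A quadratic polynomial is invariant under the reflection about its vertex. -/
lemma eval_reflection_of_degree_eq_two {k : Type*} [Field k] {P : k[X]}
    (hdeg : P.degree = 2) (x : k) :
    P.eval (-1 * x + -(P.coeff 1 / P.coeff 2)) = P.eval x := by
  have ha : P.coeff 2 ≠ 0 := coeff_ne_zero_of_eq_degree hdeg
  rw [eq_quadratic_of_degree_le_two hdeg.le]
  simp only [eval_add, eval_mul, eval_C, eval_pow, eval_X, coeff_add, coeff_C_mul, coeff_X_pow,
    coeff_X, coeff_C]
  norm_num
  field_simp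
  ring

theorem quadratic_preimage_is_exceptional {k : Type*} [Field k] [IsAlgClosed k]
    [CharZero k] (B : Set k) (hB : B.Finite) (hne : B.Nonempty)
    (A : Set k) (P : Polynomial k) (hdeg : P.degree = 2)
    (hA : A = {x : k | Polynomial.eval x P ∈ B}) :
    (∃ c c' : k, c ≠ 0 ∧ (fun x : k => c * x + c') ≠ id ∧
      (∀ x : k, c * (c * x + c') + c' = x) ∧ (fun x : k => c * x + c') '' A = A) ∧
    Even (Nat.card (MulAction.stabilizer (k ≃ᵃ[k] k) A)) := by
  set c' : k := -(P.coeff 1 / P.coeff 2) with hc'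
  have hinv : ∀ x : k, -1 * (-1 * x + c') + c' = x := fun x => by ring
  have hmem : ∀ x ∈ A, -1 * x + c' ∈ A := by
    intro x hx
    rw [hA, Set.mem_ofPred_eq] at hx ⊢
    rwa [hc', eval_reflection_of_degree_eq_two hdeg]
  have himage : (fun x : k => -1 * x + c') '' A = A :=
    Set.Subset.antisymm (Set.image_subset_iff.2 hmem)
      fun x hx => ⟨-1 * x + c', hmem x hx, hinv x⟩
  have hid : (fun x : k => -1 * x + c') ≠ id := by
    intro h
    have h₀ := congrFun h 0
    have h₁ := congrFun h 1
    simp only [id] at h₀ h₁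
    have : (2 : k) = 0 := by linear_combination h₀ - h₁
    exact two_ne_zero this
  refine ⟨⟨-1, c', by simp, hid, hinv, himage⟩, ?_⟩
  let g : k ≃ᵃ[k] k := AffineEquiv.pointReflection k (c' / 2)
  have hg : ⇑g = fun x : k => -1 * x + c' := by
    funext x
    simp only [g, AffineEquiv.pointReflection_apply, vsub_eq_sub, vadd_eq_add]
    ring
  have hgA : g ∈ MulAction.stabilizer (k ≃ᵃ[k] k) A := by
    rw [MulAction.mem_stabilizer_iff]
    change ⇑g '' A = A
    rw [hg, himage]
  have horder : orderOf (⟨g, hgA⟩ : MulAction.stabilizer (k ≃ᵃ[k] k) A) = 2 := by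
    rw [Subgroup.orderOf_mk]
    refine orderOf_eq_prime ?_ ?_
    · ext x
      change g (g x) = x
      simp only [hg, hinv]
    · intro h
      apply hid
      rw [← hg, h]
      rfl
  exact even_iff_two_dvd.2 (horder ▸ orderOf_dvd_natCard _)
end

section
/- Let k be an algebraically closed field of characteristic 0, let n ≥ 1, and let A, B, B' ⊆ k be finite sets with |A| = 2n and |B| = |B'| = n. If A ≤_p B and A ≤_p B', then B ≡_p B'. -/
open Pointwise

open Polynomial

section

variable {k : Type*} [Field k]

/-- A polynomial reducing a nonempty finite set to some set is nonconstant. -/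
theorem natDegree_pos_of_preimage [Infinite k] {A B : Set k} {P : k[X]} (hA : A.Finite)
    (hne : A.Nonempty) (h : A = {x : k | P.eval x ∈ B}) : 0 < P.natDegree := by
  by_contra! h0
  obtain ⟨c, rfl⟩ := natDegree_eq_zero.mp (Nat.le_zero.mp h0)
  obtain ⟨a, ha⟩ := hne
  have hc : c ∈ B := by
    rw [h] at ha
    simpa using ha
  have hU : A = Set.univ := by
    rw [h]
    ext x
    simpa using hc
  exact Set.infinite_univ (hU ▸ hA)

/-- Counted with multiplicity, the preimage of `B` under `P` has `B.card * P.natDegree` points. -/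
theorem sum_rootMultiplicity_preimage [IsAlgClosed k] {P : k[X]} (hP : 0 < P.natDegree)
    {A B : Finset k} (h : ∀ x, x ∈ A ↔ P.eval x ∈ B) :
    ∑ a ∈ A, (P - C (P.eval a)).rootMultiplicity a = B.card * P.natDegree := by
  classical
  rw [← Finset.sum_fiberwise_of_maps_to (fun x hx => (h x).mp hx), ← smul_eq_mul,
    ← Finset.sum_const]
  refine Finset.sum_congr rfl fun b hb => ?_
  have hne : P - C b ≠ 0 := by
    intro h0
    rw [sub_eq_zero.mp h0, natDegree_C] at hP
    exact hP.false
  have hcard : Multiset.card (P - C b).roots = P.natDegree := by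
    rw [← natDegree_sub_C (a := b) (p := P)]
    exact (IsAlgClosed.splits (P - C b)).natDegree_eq_card_roots.symm
  rw [← hcard, ← Multiset.toFinset_sum_count_eq]
  have hS : (P - C b).roots.toFinset = A.filter (fun a => P.eval a = b) := by
    ext x
    simp only [Multiset.mem_toFinset, mem_roots hne, IsRoot.def, eval_sub, eval_C,
      Finset.mem_filter, h, sub_eq_zero]
    exact ⟨fun hx => ⟨hx ▸ hb, hx⟩, fun hx => hx.2⟩
  rw [hS]
  refine Finset.sum_congr rfl fun a ha => ?_
  rw [count_roots, (Finset.mem_filter.mp ha).2]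

theorem rootMultiplicity_sub_C_eval [CharZero k] {P : k[X]} (hP : 0 < P.natDegree) (a : k) :
    (P - C (P.eval a)).rootMultiplicity a = (derivative P).rootMultiplicity a + 1 := by
  have hne : P - C (P.eval a) ≠ 0 := by
    intro h0
    rw [sub_eq_zero.mp h0, natDegree_C] at hP
    exact hP.false
  have hr : (P - C (P.eval a)).IsRoot a := by simp
  have h1 := derivative_rootMultiplicity_of_root hr
  have h2 := (rootMultiplicity_pos hne).mpr hr
  simp only [derivative_sub, derivative_C, sub_zero] at h1
  omega

theorem card_preimage_le [IsAlgClosed k] [CharZero k] {P : k[X]} (hP : 0 < P.natDegree)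
    {A B : Finset k} (h : ∀ x, x ∈ A ↔ P.eval x ∈ B) :
    A.card ≤ B.card * P.natDegree := by
  rw [← sum_rootMultiplicity_preimage hP h, Finset.card_eq_sum_ones]
  refine Finset.sum_le_sum fun a _ => ?_
  rw [rootMultiplicity_sub_C_eval hP]
  omega

/-- Riemann–Hurwitz bound for polynomial maps of the line. -/
theorem card_mul_natDegree_le [IsAlgClosed k] [CharZero k] {P : k[X]} (hP : 0 < P.natDegree)
    {A B : Finset k} (h : ∀ x, x ∈ A ↔ P.eval x ∈ B) :
    B.card * P.natDegree ≤ A.card + (P.natDegree - 1) := by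
  classical
  rw [← sum_rootMultiplicity_preimage hP h,
    Finset.sum_congr rfl fun a _ => rootMultiplicity_sub_C_eval hP a, Finset.sum_add_distrib,
    ← Finset.card_eq_sum_ones, add_comm]
  refine Nat.add_le_add_left ?_ _
  calc ∑ a ∈ A, (derivative P).rootMultiplicity a
      = ∑ a ∈ A, (derivative P).roots.count a := by simp only [count_roots]
    _ ≤ ∑ a ∈ A ∪ (derivative P).roots.toFinset, (derivative P).roots.count a :=
        Finset.sum_le_sum_of_subset Finset.subset_union_left
    _ = Multiset.card (derivative P).roots :=
        Multiset.sum_count_eq_card fun a ha =>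
          Finset.mem_union_right _ (Multiset.mem_toFinset.mpr ha)
    _ ≤ (derivative P).natDegree := card_roots' _
    _ ≤ P.natDegree - 1 := natDegree_derivative_le P

theorem natDegree_eq_two_of_card_preimage [IsAlgClosed k] [CharZero k] {n : ℕ} (hn : 3 ≤ n)
    {A B : Set k} (hA : A.Finite) (hB : B.Finite) (hAcard : A.ncard = 2 * n)
    (hBcard : B.ncard = n) {P : k[X]} (h : A = {x : k | P.eval x ∈ B}) :
    P.natDegree = 2 := by
  have hne : A.Nonempty := by
    rw [← Set.ncard_pos hA]
    omega
  have hP := natDegree_pos_of_preimage hA hne h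
  lift A to Finset k using hA
  lift B to Finset k using hB
  rw [Set.ncard_coe_finset] at hAcard hBcard
  have hmem : ∀ x, x ∈ A ↔ P.eval x ∈ B := fun x => by
    rw [← Finset.mem_coe, h]
    simp
  have h1 := card_preimage_le hP hmem
  have h2 := card_mul_natDegree_le hP hmem
  rw [hAcard, hBcard] at h1 h2
  have h3 : 2 ≤ P.natDegree := by nlinarith
  obtain ⟨e, he⟩ := Nat.exists_eq_add_of_le h3
  rw [he] at h2 ⊢
  have h4 : n * (2 + e) ≤ 2 * n + (1 + e) := by omega
  have h5 : 3 * e ≤ n * e := Nat.mul_le_mul_right e hn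
  nlinarith

/-- A finite set which is the preimage of a set under a quadratic polynomial is symmetric, so its
sum is determined by the axis of the polynomial. -/
theorem two_mul_sum_preimage_quadratic {a b c : k} (ha : a ≠ 0) {A : Finset k} {B : Set k}
    (h : ∀ x, x ∈ A ↔ a * x ^ 2 + b * x + c ∈ B) :
    2 * ∑ x ∈ A, x = A.card * (-b / a) := by
  have hsymm : ∀ x ∈ A, -b / a - x ∈ A := fun x hx => by
    rw [h] at hx ⊢
    convert hx using 1
    field_simp
    ring
  have hs : ∑ x ∈ A, x = ∑ x ∈ A, (-b / a - x) :=
    Finset.sum_bij' (fun x _ => -b / a - x) (fun x _ => -b / a - x) hsymm hsymm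
      (fun x _ => by ring) (fun x _ => by ring) (fun x _ => by ring)
  rw [Finset.sum_sub_distrib, Finset.sum_const, nsmul_eq_mul] at hs
  linear_combination hs

theorem PolyRed.of_affine {B B' : Set k} (u v : k) (h : ∀ y, y ∈ B ↔ u * y + v ∈ B') :
    PolyRed B B' :=
  ⟨C u * X + C v, by ext y; simp [h]⟩

theorem polyRed_of_quadratic [IsAlgClosed k] [CharZero k] {A B B' : Set k} (hA : A.Finite)
    (hne : A.Nonempty) {P P' : k[X]} (hP : P.natDegree = 2) (hP' : P'.natDegree = 2)
    (h : A = {x : k | P.eval x ∈ B}) (h' : A = {x : k | P'.eval x ∈ B'}) :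
    PolyRed B B' := by
  have hsurj : ∀ y, ∃ x, P.eval x = y := fun y => by
    obtain ⟨x, hx⟩ := IsAlgClosed.exists_root (P - C y) (by
      intro h0
      have := natDegree_eq_zero_iff_degree_le_zero.mpr h0.le
      rw [natDegree_sub_C, hP] at this
      omega)
    exact ⟨x, by simpa [sub_eq_zero] using hx⟩
  have ha : P.coeff 2 ≠ 0 := by
    rw [← hP, coeff_natDegree, leadingCoeff_ne_zero]
    rintro rfl
    simp at hP
  have ha' : P'.coeff 2 ≠ 0 := by
    rw [← hP', coeff_natDegree, leadingCoeff_ne_zero]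
    rintro rfl
    simp at hP'
  have eval_eq : ∀ (Q : k[X]), Q.natDegree = 2 → ∀ x,
      Q.eval x = Q.coeff 2 * x ^ 2 + Q.coeff 1 * x + Q.coeff 0 := fun Q hQ x => by
    rw [eval_eq_sum_range, hQ]
    simp only [Finset.sum_range_succ, Finset.sum_range_zero]
    ring
  lift A to Finset k using hA
  have hm : ∀ x, x ∈ A ↔ P.eval x ∈ B := fun x => by
    rw [← Finset.mem_coe, h]
    simp
  have hm' : ∀ x, x ∈ A ↔ P'.eval x ∈ B' := fun x => by
    rw [← Finset.mem_coe, h']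
    simp
  have hs := two_mul_sum_preimage_quadratic ha (B := B) (A := A) (b := P.coeff 1)
    (c := P.coeff 0) (fun x => by rw [hm, eval_eq P hP])
  have hs' := two_mul_sum_preimage_quadratic ha' (B := B') (A := A) (b := P'.coeff 1)
    (c := P'.coeff 0) (fun x => by rw [hm', eval_eq P' hP'])
  have hcard : (A.card : k) ≠ 0 :=
    Nat.cast_ne_zero.mpr (Finset.card_ne_zero.mpr (by simpa using hne))
  have haxis := mul_left_cancel₀ hcard (hs.symm.trans hs')
  rw [div_eq_div_iff ha ha'] at haxis
  refine PolyRed.of_affine (P'.coeff 2 / P.coeff 2)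
    (P'.coeff 0 - P'.coeff 2 / P.coeff 2 * P.coeff 0) fun y => ?_
  obtain ⟨x, rfl⟩ := hsurj y
  rw [← hm, hm', eval_eq P hP, eval_eq P' hP']
  suffices hL : P'.coeff 2 * x ^ 2 + P'.coeff 1 * x + P'.coeff 0 =
      P'.coeff 2 / P.coeff 2 * (P.coeff 2 * x ^ 2 + P.coeff 1 * x + P.coeff 0) +
        (P'.coeff 0 - P'.coeff 2 / P.coeff 2 * P.coeff 0) by rw [hL]
  field_simp
  linear_combination x * haxis

theorem polyRed_of_ncard_eq_one {B B' : Set k} (hB : B.ncard = 1) (hB' : B'.ncard = 1) :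
    PolyRed B B' := by
  obtain ⟨u, rfl⟩ := Set.ncard_eq_one.mp hB
  obtain ⟨u', rfl⟩ := Set.ncard_eq_one.mp hB'
  refine PolyRed.of_affine 1 (u' - u) fun y => ?_
  simp only [Set.mem_singleton_iff]
  constructor <;> intro h <;> linear_combination h

theorem polyRed_of_ncard_eq_two {B B' : Set k} (hB : B.ncard = 2) (hB' : B'.ncard = 2) :
    PolyRed B B' := by
  obtain ⟨u, v, huv, rfl⟩ := Set.ncard_eq_two.mp hB
  obtain ⟨u', v', huv', rfl⟩ := Set.ncard_eq_two.mp hB'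
  have hd : v - u ≠ 0 := sub_ne_zero.mpr huv.symm
  have hd' : (v' - u') / (v - u) ≠ 0 := div_ne_zero (sub_ne_zero.mpr huv'.symm) hd
  refine PolyRed.of_affine ((v' - u') / (v - u)) (u' - (v' - u') / (v - u) * u) fun y => ?_
  have hv : v' = (v' - u') / (v - u) * v + (u' - (v' - u') / (v - u) * u) := by
    field_simp
    ring
  simp only [Set.mem_insert_iff, Set.mem_singleton_iff]
  refine or_congr ⟨fun h => by rw [h]; ring, fun h => mul_left_cancel₀ hd' ?_⟩
    ⟨fun h => by rw [h]; exact hv.symm, fun h => mul_left_cancel₀ hd' ?_⟩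
  · linear_combination h
  · linear_combination h + hv

end

theorem no_common_predecessor_of_size_two_n {k : Type*} [Field k] [IsAlgClosed k]
    [CharZero k] (n : ℕ) (hn : 1 ≤ n) (A B B' : Set k)
    (hA : A.Finite) (hB : B.Finite) (hB' : B'.Finite)
    (hAcard : A.ncard = 2 * n) (hBcard : B.ncard = n) (hB'card : B'.ncard = n)
    (h1 : PolyRed A B) (h2 : PolyRed A B') :
    PolyEquiv B B' := by
  have hne : A.Nonempty := by
    rw [← Set.ncard_pos hA]
    omega
  obtain rfl | rfl | hn3 : n = 1 ∨ n = 2 ∨ 3 ≤ n := by omega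
  · exact ⟨polyRed_of_ncard_eq_one hBcard hB'card, polyRed_of_ncard_eq_one hB'card hBcard⟩
  · exact ⟨polyRed_of_ncard_eq_two hBcard hB'card, polyRed_of_ncard_eq_two hB'card hBcard⟩
  · obtain ⟨P, hP⟩ := h1
    obtain ⟨P', hP'⟩ := h2
    have hd := natDegree_eq_two_of_card_preimage hn3 hA hB hAcard hBcard hP
    have hd' := natDegree_eq_two_of_card_preimage hn3 hA hB' hAcard hB'card hP'
    exact ⟨polyRed_of_quadratic hA hne hd hd' hP hP', polyRed_of_quadratic hA hne hd' hd hP' hP⟩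
end

section
/- Let k be an algebraically closed field of characteristic 0 and let κ be the cardinality of k. Then there exists a family F of subsets of k with |F| = 2^κ such that: every A ∈ F satisfies |A| = κ and |k \ A| = κ; every A ∈ F is ≤_p-maximal, i.e. for every C ⊆ k, if A ≤_p C then C ≤_p A; and distinct members of F are not polynomially bireducible, i.e. for A, A' ∈ F, A ≡_p A' implies A = A'. -/
open Pointwise

open Polynomial in
/-- Away from the critical points, a polynomial of degree at least two over an algebraically
closed field is not injective. -/
theorem exists_ne_eval_eq {k : Type*} [Field k] [IsAlgClosed k] {P : k[X]}
    (hP : 2 ≤ P.natDegree) {x : k} (hx : (derivative P).eval x ≠ 0) :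
    ∃ y, x ≠ y ∧ P.eval x = P.eval y := by
  have hroot : (P - C (P.eval x)).IsRoot x := by simp
  obtain ⟨Q, hQ⟩ := dvd_iff_isRoot.2 hroot
  have hdeg : (P - C (P.eval x)).natDegree = P.natDegree := natDegree_sub_C
  have hQ0 : Q ≠ 0 := by
    rintro rfl
    rw [mul_zero] at hQ
    rw [hQ, natDegree_zero] at hdeg
    omega
  rw [hQ, natDegree_mul (X_sub_C_ne_zero x) hQ0, natDegree_X_sub_C] at hdeg
  obtain ⟨y, hy⟩ := IsAlgClosed.exists_root Q
    (fun h => by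
      have : Q.natDegree = 0 := natDegree_eq_of_degree_eq_some h
      omega)
  refine ⟨y, ?_, ?_⟩
  · rintro rfl
    apply hx
    have h := congrArg (fun R => (derivative R).eval x) hQ
    simpa [derivative_mul, hy.eq_zero] using h
  · have h := congrArg (eval y) hQ
    simp only [eval_sub, eval_C, eval_mul, hy.eq_zero, mul_zero] at h
    exact (sub_eq_zero.1 h).symm

open Polynomial Cardinal in
/-- A polynomial of degree at least two identifies two distinct points outside any prescribed
small set. -/
theorem exists_ne_eval_eq_notMem {k : Type*} [Field k] [IsAlgClosed k] [CharZero k] {P : k[X]}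
    (hP : 2 ≤ P.natDegree) {U : Set k} (hU : #U < #k) :
    ∃ x y, x ∉ U ∧ y ∉ U ∧ x ≠ y ∧ P.eval x = P.eval y := by
  have hk : ℵ₀ ≤ #k := aleph0_le_mk k
  have hd : derivative P ≠ 0 := fun h => by
    have := derivative_eq_zero.1 h
    omega
  let V : Set k := ⋃ u : U, {z | P.eval z = P.eval (u : k)}
  have hfib : ∀ u : k, #{z | P.eval z = P.eval u} ≤ P.natDegree := fun u => by
    classical
    have h0 : P - C (P.eval u) ≠ 0 := fun h => by
      have := natDegree_sub_C (p := P) (a := P.eval u)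
      rw [h, natDegree_zero] at this
      omega
    have hroots : {z | P.eval z = P.eval u} = ((P - C (P.eval u)).roots.toFinset : Set k) := by
      ext z
      simp [h0, sub_eq_zero]
    rw [hroots]
    refine mk_coe_finset.trans_le (Nat.cast_le.2 ?_)
    rw [← natDegree_sub_C (p := P) (a := P.eval u)]
    exact (Multiset.toFinset_card_le _).trans (card_roots' _)
  have hfin : ({z | (derivative P).eval z = 0} : Set k).Finite := finite_setOfPred_isRoot hd
  have hV : #V < #k := calc
    #V ≤ sum fun u : U => #{z | P.eval z = P.eval (u : k)} := mk_iUnion_le_sum_mk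
    _ ≤ sum fun _ : U => (P.natDegree : Cardinal) := sum_le_sum _ _ fun u => hfib u
    _ = #U * P.natDegree := sum_const' _ _
    _ < #k := mul_lt_of_lt hk hU (natCast_lt_aleph0.trans_le hk)
  have hW : #(V ∪ {z | (derivative P).eval z = 0} : Set k) < #k :=
    (mk_union_le _ _).trans_lt (add_lt_of_lt hk hV (hfin.lt_aleph0.trans_le hk))
  obtain ⟨x, hx⟩ : ∃ x, x ∉ V ∪ {z | (derivative P).eval z = 0} := by
    by_contra! h
    rw [Set.eq_univ_of_forall h, mk_univ] at hW
    exact hW.false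
  simp only [Set.mem_union, not_or] at hx
  obtain ⟨y, hxy, he⟩ := exists_ne_eval_eq hP hx.2
  exact ⟨x, y, fun h => hx.1 (Set.mem_iUnion.2 ⟨⟨x, h⟩, rfl⟩),
    fun h => hx.1 (Set.mem_iUnion.2 ⟨⟨y, h⟩, he⟩), hxy, he⟩

open Cardinal in
/-- If each of at most `#α` relations is satisfied by a pair of distinct points outside any given
small set, then one can choose witnessing pairs all of whose entries are distinct. -/
theorem exists_disjoint_pairs.{u} {ι α : Type u} [Infinite α] (hι : #ι ≤ #α)
    (R : ι → α → α → Prop)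
    (hR : ∀ i, ∀ U : Set α, #U < #α → ∃ x y, x ∉ U ∧ y ∉ U ∧ x ≠ y ∧ R i x y) :
    ∃ f g : ι → α, f.Injective ∧ g.Injective ∧ (∀ i j, f i ≠ g j) ∧ ∀ i, R i (f i) (g i) := by
  obtain ⟨_, _, hord⟩ := exists_ord_eq_type_lt ι
  choose! x y hx hy hxy hRxy using hR
  let U (i : ι) (p : ∀ j, j < i → α × α) : Set α :=
    (Set.range fun j : Set.Iio i => (p j j.2).1) ∪ Set.range fun j : Set.Iio i => (p j j.2).2
  have hU : ∀ i p, #(U i p) < #α := fun i p =>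
    have hi : #(Set.Iio i) < #α := (mk_Iio_lt i hord).trans_le hι
    (mk_union_le _ _).trans_lt
      (add_lt_of_lt (aleph0_le_mk α) (mk_range_le.trans_lt hi) (mk_range_le.trans_lt hi))
  obtain ⟨h, h_eq⟩ : ∃ h : ι → α × α,
      ∀ i, h i = (x i (U i fun j _ => h j), y i (U i fun j _ => h j)) :=
    ⟨_, (wellFounded_lt (α := ι)).fix_eq fun i p => (x i (U i p), y i (U i p))⟩
  have hspec : ∀ i, ∃ W : Set α, #W < #α ∧ h i = (x i W, y i W) ∧
      ∀ j < i, (h j).1 ∈ W ∧ (h j).2 ∈ W := fun i =>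
    ⟨U i fun j _ => h j, hU i fun j _ => h j, h_eq i,
      fun j hj => ⟨.inl ⟨⟨j, hj⟩, rfl⟩, .inr ⟨⟨j, hj⟩, rfl⟩⟩⟩
  choose W hW hh hmem using hspec
  have h_fst : ∀ i, (h i).1 ∉ W i := fun i => hh i ▸ hx i (W i) (hW i)
  have h_snd : ∀ i, (h i).2 ∉ W i := fun i => hh i ▸ hy i (W i) (hW i)
  refine ⟨fun i => (h i).1, fun i => (h i).2, ?_, ?_, ?_, ?_⟩
  · intro i j hij
    dsimp only at hij
    rcases lt_trichotomy i j with hlt | rfl | hlt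
    · exact (h_fst j (hij ▸ (hmem _ _ hlt).1)).elim
    · rfl
    · exact (h_fst i (hij ▸ (hmem _ _ hlt).1)).elim
  · intro i j hij
    dsimp only at hij
    rcases lt_trichotomy i j with hlt | rfl | hlt
    · exact (h_snd j (hij ▸ (hmem _ _ hlt).2)).elim
    · rfl
    · exact (h_snd i (hij ▸ (hmem _ _ hlt).2)).elim
  · intro i j hij
    dsimp only at hij
    rcases lt_trichotomy i j with hlt | rfl | hlt
    · exact h_snd j (hij ▸ (hmem _ _ hlt).1)
    · exact hxy i _ (hW i) (by simpa [hh i] using hij)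
    · exact h_fst i (hij ▸ (hmem _ _ hlt).2)
  · intro i
    simp only [hh i]
    exact hRxy i _ (hW i)

theorem PolyRed.refl {k : Type*} [Field k] (A : Set k) : PolyRed A A :=
  ⟨Polynomial.X, by simp⟩

theorem PolyRed.trans {k : Type*} [Field k] {A B C : Set k} (hAB : PolyRed A B)
    (hBC : PolyRed B C) : PolyRed A C := by
  obtain ⟨P, rfl⟩ := hAB
  obtain ⟨Q, rfl⟩ := hBC
  exact ⟨Q.comp P, by simp⟩

theorem polyEquiv_equivalence (k : Type*) [Field k] : Equivalence (PolyEquiv (k := k)) where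
  refl A := ⟨.refl A, .refl A⟩
  symm h := ⟨h.2, h.1⟩
  trans h₁ h₂ := ⟨h₁.1.trans h₂.1, h₂.2.trans h₁.2⟩

open Polynomial in
/-- Reductions along a polynomial of degree one can be reversed. -/
theorem PolyRed.of_natDegree_eq_one {k : Type*} [Field k] {A C : Set k} {P : k[X]}
    (hP : P.natDegree = 1) (hA : A = {x | P.eval x ∈ C}) : PolyRed C A := by
  obtain ⟨a, ha, b, rfl⟩ := natDegree_eq_one.1 hP
  refine ⟨Polynomial.C a⁻¹ * (X - Polynomial.C b), ?_⟩
  ext x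
  simp [hA, ha]

open Polynomial in
/-- A nontrivial set that is not saturated for any polynomial of degree at least two is
maximal. -/
theorem polyRed_symm_of_forall_not_saturated {k : Type*} [Field k] {A : Set k}
    (h₁ : A.Nonempty) (h₂ : Aᶜ.Nonempty)
    (h : ∀ P : k[X], 2 ≤ P.natDegree → ∃ x ∈ A, ∃ y ∉ A, P.eval x = P.eval y)
    {C : Set k} (hAC : PolyRed A C) : PolyRed C A := by
  obtain ⟨P, hP⟩ := hAC
  refine .of_natDegree_eq_one ?_ hP
  have hsat : ∀ x ∈ A, ∀ y ∉ A, P.eval x ≠ P.eval y := by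
    rw [hP]
    intro x hx y hy hxy
    exact hy (show P.eval y ∈ C from hxy ▸ hx)
  have hlt : P.natDegree < 2 := by
    by_contra! hdeg
    obtain ⟨x, hx, y, hy, hxy⟩ := h P hdeg
    exact hsat x hx y hy hxy
  have hne : P.natDegree ≠ 0 := fun h0 => by
    obtain ⟨c, rfl⟩ := natDegree_eq_zero.1 h0
    obtain ⟨x, hx⟩ := h₁
    obtain ⟨y, hy⟩ := h₂
    exact hsat x hx y hy (by simp)
  omega

open Cardinal in
/-- Every family of `2 ^ #k` sets contains `2 ^ #k` pairwise inequivalent members, because only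
`#k` sets reduce to a given one. -/
theorem exists_polyEquiv_transversal {k : Type*} [Field k] [Infinite k] {G : Set (Set k)}
    (hG : #G = 2 ^ #k) :
    ∃ F ⊆ G, #F = 2 ^ #k ∧ ∀ A ∈ F, ∀ A' ∈ F, PolyEquiv A A' → A = A' := by
  let s : Setoid G := (⟨PolyEquiv, polyEquiv_equivalence k⟩ : Setoid (Set k)).comap (↑)
  have hs : ∀ A : G, PolyEquiv (A : Set k) ((⟦A⟧ : Quotient s).out : G) := fun A =>
    (Quotient.exact (Quotient.out_eq (⟦A⟧ : Quotient s)).symm : s A _)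
  choose P hP using fun A => (hs A).1
  have hle : #G ≤ #(Quotient s) * #k := by
    have hinj : Function.Injective fun A : G => ((⟦A⟧ : Quotient s), P A) := by
      intro A B hAB
      obtain ⟨h₁, h₂⟩ := Prod.mk.inj hAB
      apply Subtype.ext
      rw [hP A, hP B, h₁, h₂]
    have hpoly : #(Polynomial k) ≤ #k := by
      rw [Polynomial.cardinalMk_eq_max, max_eq_left (aleph0_le_mk k)]
    refine (mk_le_of_injective hinj).trans ?_
    rw [mk_prod, lift_id, lift_id]
    gcongr
  refine ⟨Set.range fun q : Quotient s => (q.out : Set k), ?_, ?_, ?_⟩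
  · rintro _ ⟨q, rfl⟩
    exact q.out.2
  · rw [mk_range_eq (fun q : Quotient s => (q.out : Set k))
      (Subtype.val_injective.comp Quotient.out_injective)]
    apply le_antisymm
    · exact hG ▸ mk_quotient_le
    · by_contra! hlt
      have := mul_lt_of_lt ((aleph0_le_mk k).trans (cantor #k).le) hlt (cantor #k)
      exact (hG ▸ hle).not_gt this
  · rintro _ ⟨p, rfl⟩ _ ⟨q, rfl⟩ h
    have : p = q := by
      rw [← Quotient.out_eq p, ← Quotient.out_eq q]
      exact Quotient.sound h
    rw [this]

open Polynomial Cardinal in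
theorem mk_natDegree_ge_two (k : Type*) [Field k] [Infinite k] :
    #{P : k[X] // 2 ≤ P.natDegree} = #k := by
  apply le_antisymm
  · refine (mk_subtype_le _).trans ?_
    rw [cardinalMk_eq_max, max_eq_left (aleph0_le_mk k)]
  · refine mk_le_of_injective
      (f := fun a : k => (⟨X ^ 2 + C a, natDegree_X_pow_add_C.ge⟩ : {P : k[X] // 2 ≤ P.natDegree}))
      fun a b hab => ?_
    simpa using hab

theorem many_maximal_classes {k : Type*} [Field k] [IsAlgClosed k] [CharZero k] :
    ∃ F : Set (Set k), Cardinal.mk F = 2 ^ Cardinal.mk k ∧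
      (∀ A ∈ F, Cardinal.mk A = Cardinal.mk k ∧
        Cardinal.mk ↥(Aᶜ : Set k) = Cardinal.mk k) ∧
      (∀ A ∈ F, ∀ C : Set k, PolyRed A C → PolyRed C A) ∧
      (∀ A ∈ F, ∀ A' ∈ F, PolyEquiv A A' → A = A') := by
  let I := {P : Polynomial k // 2 ≤ P.natDegree}
  have hI : Cardinal.mk I = Cardinal.mk k := mk_natDegree_ge_two k
  have hII : Cardinal.mk (I ⊕ I) = Cardinal.mk k := by
    rw [Cardinal.mk_sum, Cardinal.lift_id, hI, Cardinal.add_eq_self (Cardinal.aleph0_le_mk k)]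
  obtain ⟨f, g, hf, hg, hfg, hR⟩ := exists_disjoint_pairs (ι := I ⊕ I) (α := k) (by rw [hII])
    (fun i x y => (i.elim id id).1.eval x = (i.elim id id).1.eval y)
    (fun i U hU => exists_ne_eval_eq_notMem (i.elim id id).2 hU)
  -- The left copy of `I` enforces maximality, the right copy is free.
  let A : Set I → Set k := fun S => f '' (Set.range Sum.inl ∪ Sum.inr '' S)
  have hinl : ∀ S i, f (.inl i) ∈ A S := fun S i => ⟨_, .inl ⟨i, rfl⟩, rfl⟩
  have hgA : ∀ S i, g i ∉ A S := by
    rintro S i ⟨j, -, h⟩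
    exact hfg _ _ h
  have hA : A.Injective := by
    intro S T h
    have h := hf.image_injective h
    ext i
    simpa using congrArg (Sum.inr i ∈ ·) h
  obtain ⟨F, hFG, hF, hinj⟩ := exists_polyEquiv_transversal (G := Set.range A) (by
    rw [Cardinal.mk_range_eq _ hA, Cardinal.mk_set, hI])
  refine ⟨F, hF, ?_, ?_, hinj⟩
  · intro B hB
    obtain ⟨S, rfl⟩ := hFG hB
    constructor
    · refine (Cardinal.mk_set_le _).antisymm (hI ▸ Cardinal.mk_le_of_injective
        (f := fun i : I => (⟨f (.inl i), hinl S i⟩ : A S)) fun i j h => ?_)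
      exact Sum.inl_injective (hf (congrArg Subtype.val h))
    · refine (Cardinal.mk_set_le _).antisymm (hII ▸ Cardinal.mk_le_of_injective
        (f := fun i : I ⊕ I => (⟨g i, hgA S i⟩ : ((A S)ᶜ : Set k))) fun i j h => ?_)
      exact hg (congrArg Subtype.val h)
  · intro B hB C
    obtain ⟨S, rfl⟩ := hFG hB
    have i₀ : I := (Cardinal.mk_ne_zero_iff.1 (hI ▸ Cardinal.mk_ne_zero k)).some
    exact polyRed_symm_of_forall_not_saturated ⟨_, hinl S i₀⟩ ⟨_, hgA S (.inl i₀)⟩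
      fun P hP => ⟨_, hinl S ⟨P, hP⟩, _, hgA S (.inl ⟨P, hP⟩), hR (.inl ⟨P, hP⟩)⟩
end

section
/- Let k be a countable algebraically closed field of characteristic 0. Identify subsets of k with their characteristic functions in the space k → Bool, endowed with the product topology where Bool is discrete. Then the set {f : k → Bool | the set {x ∈ k | f(x) = true} is ≤_p-maximal} is comeagre (residual) in k → Bool. -/
open Pointwise

/-- A polynomial of degree other than one takes some of its values twice, even at a first
argument outside a prescribed finite set. -/
theorem Polynomial.exists_notMem_exists_ne_eval_eq {k : Type*} [Field k] [IsAlgClosed k]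
    [CharZero k] {P : Polynomial k} (hP : P.natDegree ≠ 1) (S : Finset k) :
    ∃ x ∉ S, ∃ y, y ≠ x ∧ P.eval y = P.eval x := by
  classical
  rcases Nat.eq_zero_or_pos P.natDegree with h0 | hpos
  · obtain ⟨x, hx⟩ := S.exists_notMem
    rw [Polynomial.eq_C_of_natDegree_eq_zero h0]
    exact ⟨x, hx, x + 1, by simp, by simp⟩
  · have hd : P.derivative ≠ 0 := fun h =>
      hpos.ne' (Polynomial.derivative_eq_zero.1 h)
    obtain ⟨x, hx⟩ := (S ∪ P.derivative.roots.toFinset).exists_notMem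
    simp only [Finset.mem_union, Multiset.mem_toFinset, Polynomial.mem_roots hd, not_or,
      Polynomial.IsRoot.def] at hx
    obtain ⟨Q, hQ⟩ := Polynomial.X_sub_C_dvd_sub_C_eval (a := x) (p := P)
    have hPQ : P = (Polynomial.X - Polynomial.C x) * Q + Polynomial.C (P.eval x) := by
      rw [← hQ, sub_add_cancel]
    have hQdeg : Q.degree ≠ 0 := fun h => hP <| by
      rw [hPQ, Polynomial.natDegree_add_C, Polynomial.eq_C_of_degree_eq_zero h,
        Polynomial.natDegree_mul_C (fun h' => ?_), Polynomial.natDegree_X_sub_C]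
      rw [Polynomial.eq_C_of_degree_eq_zero h, h'] at h
      simp at h
    obtain ⟨y, hy⟩ := IsAlgClosed.exists_root Q hQdeg
    refine ⟨x, hx.1, y, ?_, ?_⟩
    · rintro rfl
      apply hx.2
      rw [hPQ]
      simp [Polynomial.derivative_mul, hy.eq_zero]
    · have := congrArg (Polynomial.eval y) hPQ
      simpa [hy.eq_zero] using this

/-- For a polynomial `P` of degree other than one, the sets that are not unions of fibres of `P`
are comeagre. -/
theorem eventually_residual_exists_eval_eq_and_ne {k : Type*} [Field k] [IsAlgClosed k]
    [CharZero k] {P : Polynomial k} (hP : P.natDegree ≠ 1) :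
    ∀ᶠ f : k → Bool in residual (k → Bool), ∃ x y, P.eval x = P.eval y ∧ f x ≠ f y := by
  classical
  refine residual_of_dense_open ?_ ?_
  · simp only [Set.ofPred_exists]
    refine isOpen_iUnion fun x => isOpen_iUnion fun y => isOpen_const.and ?_
    exact isOpen_ne_fun (continuous_apply x) (continuous_apply y)
  · refine dense_iff_inter_open.2 fun U hU ⟨f, hf⟩ => ?_
    obtain ⟨I, u, hu, hIU⟩ := isOpen_pi_iff.1 hU f hf
    obtain ⟨x, hxI, y, hyx, hxy⟩ := Polynomial.exists_notMem_exists_ne_eval_eq hP I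
    refine ⟨Function.update f x (!f y), hIU fun i hi => ?_, x, y, hxy.symm, ?_⟩
    · rw [Function.update_of_ne (by rintro rfl; exact hxI hi)]
      exact (hu i hi).2
    · simp [Function.update_of_ne hyx]

/-- Reductions by polynomials of degree one can be reversed. -/
theorem polyRed_of_eq_preimage_of_natDegree_eq_one {k : Type*} [Field k] {A C : Set k}
    {P : Polynomial k} (hP : P.natDegree = 1) (hA : A = {x : k | Polynomial.eval x P ∈ C}) :
    PolyRed C A := by
  obtain ⟨a, ha, b, rfl⟩ := Polynomial.natDegree_eq_one.1 hP
  refine ⟨Polynomial.C a⁻¹ * (Polynomial.X - Polynomial.C b), ?_⟩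
  ext x
  simp [hA, ha]

theorem maximal_sets_comeagre {k : Type*} [Field k] [IsAlgClosed k] [CharZero k]
    [Countable k] :
    {f : k → Bool | ∀ C : Set k, PolyRed {x : k | f x = true} C →
      PolyRed C {x : k | f x = true}} ∈ residual (k → Bool) := by
  have h : ∀ᶠ f : k → Bool in residual (k → Bool), ∀ P : Polynomial k, P.natDegree ≠ 1 →
      ∃ x y, P.eval x = P.eval y ∧ f x ≠ f y := by
    have : Countable (Polynomial k) := Cardinal.mk_le_aleph0_iff.1 <|
      Polynomial.cardinalMk_le_max.trans (max_le (Cardinal.mk_le_aleph0_iff.2 ‹_›) le_rfl)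
    rw [eventually_countable_forall]
    intro P
    by_cases hP : P.natDegree = 1
    · simp [hP]
    · filter_upwards [eventually_residual_exists_eval_eq_and_ne hP] with f hf _ using hf
  filter_upwards [h] with f hf C ⟨P, hP⟩
  refine polyRed_of_eq_preimage_of_natDegree_eq_one (of_not_not fun hdeg => ?_) hP
  obtain ⟨x, y, hxy, hne⟩ := hf P hdeg
  have hx := Set.ext_iff.1 hP x
  have hy := Set.ext_iff.1 hP y
  simp only [Set.mem_ofPred_eq, hxy] at hx hy
  exact hne (Bool.eq_iff_iff.2 (hx.trans hy.symm))
end
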